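/- arXiv:1812.08540 — 3 statements merged into one kernel-verified Lean document; each statement's English description precedes it below -/
import Mathlib

section
/- Let φ: ℝ → ℝ be nonnegative, even, and differentiable, and suppose the function Φ defined by Φ(t) = −φ(√t) for t ≥ 0 and Φ(t) = +∞ for t < 0 is convex. Then φ = φ^{cc}; that is, setting ψ(s) := φ^c(s) = inf_{t∈ℝ} (t²·s − φ(t)), one has φ(t) = inf_{s∈ℝ} (t²·s − ψ(s)) for every t ∈ ℝ (with the convention that t²·s − ψ(s) = +∞ when ψ(s) = −∞). -/
open Filter Topology

/-- A convex function lies above its tangent lines. -/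
theorem ConvexOn.add_mul_sub_le_of_hasDerivAt {S : Set ℝ} {f : ℝ → ℝ} {f' x y : ℝ}
    (hf : ConvexOn ℝ S f) (hx : x ∈ S) (hy : y ∈ S) (h : HasDerivAt f f' x) :
    f x + f' * (y - x) ≤ f y := by
  rcases lt_trichotomy x y with hxy | rfl | hxy
  · have := hf.le_slope_of_hasDerivAt hx hy hxy h
    rw [slope_def_field, le_div_iff₀ (sub_pos.2 hxy)] at this
    linarith
  · simp
  · have := hf.slope_le_of_hasDerivAt hy hx hxy h
    rw [slope_def_field, div_le_iff₀ (sub_pos.2 hxy)] at this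
    linarith

/-- An even, nonnegative, differentiable function that is concave in `t ^ 2` has at every `u > 0` a
supporting line in the variable `t ^ 2`, whose slope is nonnegative. -/
theorem exists_nonneg_slope_le_sq {φ : ℝ → ℝ} (hnn : ∀ t, 0 ≤ φ t)
    (heven : ∀ t, φ (-t) = φ t) (hdiff : Differentiable ℝ φ)
    (hconv : ConvexOn ℝ (Set.Ici (0 : ℝ)) (fun t => -φ (Real.sqrt t))) {u : ℝ} (hu : 0 < u) :
    ∃ s : ℝ, 0 ≤ s ∧ ∀ t : ℝ, φ t ≤ φ u + s * (t ^ 2 - u ^ 2) := by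
  have hu2 : 0 < u ^ 2 := by positivity
  have hd : DifferentiableAt ℝ (fun t => -φ (Real.sqrt t)) (u ^ 2) :=
    ((hdiff _).comp _ (Real.hasDerivAt_sqrt hu2.ne').differentiableAt).neg
  set d := deriv (fun t => -φ (Real.sqrt t)) (u ^ 2)
  have key : ∀ y : ℝ, 0 ≤ y → φ (Real.sqrt y) ≤ φ u - d * (y - u ^ 2) := fun y hy => by
    have := hconv.add_mul_sub_le_of_hasDerivAt (Set.mem_Ici.2 hu2.le) (Set.mem_Ici.2 hy)
      hd.hasDerivAt
    simp only [Real.sqrt_sq hu.le] at this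
    linarith
  refine ⟨-d, ?_, fun t => ?_⟩
  · by_contra! hneg
    have hd0 : 0 < d := by linarith
    have hpos : 0 < (φ u + 1) / d := div_pos (by linarith [hnn u]) hd0
    have h1 := key (u ^ 2 + (φ u + 1) / d) (by positivity)
    rw [add_sub_cancel_left, mul_div_cancel₀ _ hd0.ne'] at h1
    linarith [hnn (Real.sqrt (u ^ 2 + (φ u + 1) / d))]
  · have h1 := key (t ^ 2) (sq_nonneg t)
    have h2 : φ |t| = φ t := by
      rcases abs_choice t with h | h <;> simp [h, heven]
    rw [Real.sqrt_sq_eq_abs, h2] at h1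
    linarith

/-- For φ : ℝ → ℝ nonnegative, even, differentiable, with
Φ(t) = −φ(√t) convex on [0,∞) (and +∞ for t < 0, i.e. convexity of the finite
part on the convex set [0,∞)), the c-transform with c(t,s) = t²s satisfies
φ = φ^{cc}: with ψ(s) = inf_t (t²s − φ(t)) (an extended real, possibly −∞),
one has φ(t) = inf_s (t²s − ψ(s)) for all t, where the EReal subtraction gives
+∞ when ψ(s) = −∞. -/
theorem stmt0 (φ : ℝ → ℝ)
    (hnn : ∀ t : ℝ, 0 ≤ φ t)
    (heven : ∀ t : ℝ, φ (-t) = φ t)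
    (hdiff : Differentiable ℝ φ)
    (hconv : ConvexOn ℝ (Set.Ici (0 : ℝ)) (fun t => -φ (Real.sqrt t)))
    (ψ : ℝ → EReal)
    (hψ : ∀ s : ℝ, ψ s = ⨅ t : ℝ, ((t ^ 2 * s - φ t : ℝ) : EReal)) :
    ∀ t : ℝ, (φ t : EReal) = ⨅ s : ℝ, (((t ^ 2 * s : ℝ) : EReal) - ψ s) := by
  have bound : ∀ u : ℝ, 0 < u → ∃ s : ℝ, 0 ≤ s ∧ ∀ t : ℝ,
      ((t ^ 2 * s : ℝ) : EReal) - ψ s ≤ ((φ u + s * (t ^ 2 - u ^ 2) : ℝ) : EReal) := by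
    intro u hu
    obtain ⟨s, hs, h⟩ := exists_nonneg_slope_le_sq hnn heven hdiff hconv hu
    refine ⟨s, hs, fun t => ?_⟩
    have hle : ((u ^ 2 * s - φ u : ℝ) : EReal) ≤ ψ s := by
      rw [hψ]
      exact le_iInf fun t => EReal.coe_le_coe_iff.2 (by linarith [h t])
    refine (EReal.sub_le_sub le_rfl hle).trans (le_of_eq ?_)
    rw [← EReal.coe_sub]
    congr 1
    ring
  intro t
  apply le_antisymm
  · refine le_iInf fun s => ?_
    have hle : ψ s ≤ ((t ^ 2 * s - φ t : ℝ) : EReal) := hψ s ▸ iInf_le _ t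
    refine (le_of_eq ?_).trans (EReal.sub_le_sub le_rfl hle)
    rw [← EReal.coe_sub, sub_sub_cancel]
  · wlog ht : 0 ≤ t generalizing t
    · simpa only [neg_sq, heven] using this (-t) (by linarith)
    rcases ht.eq_or_lt with rfl | ht
    · have hlim : Tendsto (fun u => (φ u : EReal)) (𝓝[>] 0) (𝓝 (φ 0 : EReal)) :=
        (continuous_coe_real_ereal.comp hdiff.continuous).continuousAt.tendsto.mono_left
          nhdsWithin_le_nhds
      refine ge_of_tendsto hlim (eventually_mem_nhdsWithin.mono fun u hu => ?_)
      obtain ⟨s, hs, h⟩ := bound u hu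
      refine (iInf_le _ s).trans ((h 0).trans (EReal.coe_le_coe_iff.2 ?_))
      nlinarith [mul_nonneg hs (sq_nonneg u)]
    · obtain ⟨s, -, h⟩ := bound t ht
      exact (iInf_le _ s).trans ((h t).trans (by simp))
end

section
/- Let φ: ℝ → ℝ be nonnegative, even, and differentiable, suppose the function Φ defined by Φ(t) = −φ(√t) for t ≥ 0 and Φ(t) = +∞ for t < 0 is convex, and assume in addition that φ(t)/t² → 0 as t → ∞, that φ'(t) ≥ 0 for all t ≥ 0, and that the limit φ''(0+) := lim_{t→0+} φ'(t)/t exists. Define s(t) := φ'(t)/(2t) for t > 0 and s(0) := φ''(0+)/2. Then for every t ≥ 0 the infimum in the dual representation φ(t) = inf_{s∈ℝ} (t²·s − ψ(s)), where ψ := φ^c, is attained at s = s(t); in particular φ(t) + ψ(s(t)) = t²·s(t). -/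
open Filter Topology

/-- The tangent line of `x ↦ φ (√x)` at `t ^ 2` lies above the graph, by concavity. -/
theorem sq_mul_sub_le_of_convexOn_neg_sqrt {φ : ℝ → ℝ} {t : ℝ} (ht : 0 < t)
    (heven : ∀ u : ℝ, φ (-u) = φ u) (hdiff : DifferentiableAt ℝ φ t)
    (hconv : ConvexOn ℝ (Set.Ici (0 : ℝ)) (fun x => -φ (Real.sqrt x))) (u : ℝ) :
    t ^ 2 * (deriv φ t / (2 * t)) - φ t ≤ u ^ 2 * (deriv φ t / (2 * t)) - φ u := by
  have hsqrt : Real.sqrt (t ^ 2) = t := Real.sqrt_sq ht.le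
  have hφu : φ (Real.sqrt (u ^ 2)) = φ u := by
    rw [Real.sqrt_sq_eq_abs]
    rcases abs_choice u with h | h <;> simp [h, heven]
  have hderiv : HasDerivAt (fun x => -φ (Real.sqrt x)) (-(deriv φ t / (2 * t))) (t ^ 2) := by
    have h1 := Real.hasDerivAt_sqrt (pow_pos ht 2).ne'
    have h2 : HasDerivAt φ (deriv φ t) (Real.sqrt (t ^ 2)) := by
      rw [hsqrt]; exact hdiff.hasDerivAt
    have h3 := (h2.comp _ h1).neg
    rw [hsqrt, mul_one_div] at h3
    exact h3
  have ht2 : t ^ 2 ∈ Set.Ici (0 : ℝ) := sq_nonneg t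
  have hu2 : u ^ 2 ∈ Set.Ici (0 : ℝ) := sq_nonneg u
  rcases lt_trichotomy (u ^ 2) (t ^ 2) with h | h | h
  · have := hconv.slope_le_of_hasDerivAt hu2 ht2 h hderiv
    rw [slope_def_field, div_le_iff₀ (sub_pos.2 h)] at this
    simp only [hsqrt, hφu] at this
    linarith
  · have : φ u = φ t := by rw [← hφu, h, hsqrt]
    rw [h, this]
  · have := hconv.le_slope_of_hasDerivAt ht2 hu2 h hderiv
    rw [slope_def_field, le_div_iff₀ (sub_pos.2 h)] at this
    simp only [hsqrt, hφu] at this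
    linarith

/-- Under the assumptions of Proposition (i) together with
φ(t)/t² → 0 as t → ∞, φ'(t) ≥ 0 for t ≥ 0, and the existence of
φ''(0+) = lim_{t→0+} φ'(t)/t =: L, the infimum in the dual representation
φ(t) = inf_s (t²·s − ψ(s)), ψ = φ^c, is attained for every t ≥ 0 at
s(t) = φ'(t)/(2t) (t > 0), s(0) = L/2; in particular
φ(t) + ψ(s(t)) = t²·s(t). -/
theorem stmt1 (φ : ℝ → ℝ) (L : ℝ)
    (hnn : ∀ t : ℝ, 0 ≤ φ t)
    (heven : ∀ t : ℝ, φ (-t) = φ t)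
    (hdiff : Differentiable ℝ φ)
    (hconv : ConvexOn ℝ (Set.Ici (0 : ℝ)) (fun t => -φ (Real.sqrt t)))
    (hdecay : Tendsto (fun t : ℝ => φ t / t ^ 2) atTop (𝓝 0))
    (hderiv_nn : ∀ t : ℝ, 0 ≤ t → 0 ≤ deriv φ t)
    (hL : Tendsto (fun t : ℝ => deriv φ t / t) (𝓝[>] 0) (𝓝 L))
    (ψ : ℝ → EReal)
    (hψ : ∀ s : ℝ, ψ s = ⨅ t : ℝ, ((t ^ 2 * s - φ t : ℝ) : EReal))
    (s : ℝ → ℝ)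
    (hs_pos : ∀ t : ℝ, 0 < t → s t = deriv φ t / (2 * t))
    (hs_zero : s 0 = L / 2) :
    ∀ t : ℝ, 0 ≤ t →
      ((φ t : EReal) = ⨅ σ : ℝ, (((t ^ 2 * σ : ℝ) : EReal) - ψ σ)) ∧
      ((φ t : EReal) = ((t ^ 2 * s t : ℝ) : EReal) - ψ (s t)) ∧
      ((φ t : EReal) + ψ (s t) = ((t ^ 2 * s t : ℝ) : EReal)) := by
  have hmin : ∀ t : ℝ, 0 ≤ t → ∀ u : ℝ, t ^ 2 * s t - φ t ≤ u ^ 2 * s t - φ u := by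
    intro t ht u
    rcases ht.eq_or_lt with rfl | ht
    · have hslope : Tendsto (fun t : ℝ => deriv φ t / (2 * t)) (𝓝[>] 0) (𝓝 (L / 2)) :=
        (hL.div_const 2).congr fun t => by rw [div_div, mul_comm t 2]
      have hid : Tendsto (fun t : ℝ => t) (𝓝[>] 0) (𝓝 0) := nhdsWithin_le_nhds
      have hφ : Tendsto φ (𝓝[>] 0) (𝓝 (φ 0)) :=
        (hdiff.continuous.tendsto 0).mono_left nhdsWithin_le_nhds
      rw [hs_zero]
      refine le_of_tendsto_of_tendsto (((hid.pow 2).mul hslope).sub hφ)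
        ((hslope.const_mul (u ^ 2)).sub_const (φ u)) ?_
      filter_upwards [self_mem_nhdsWithin] with t ht
      exact sq_mul_sub_le_of_convexOn_neg_sqrt ht heven (hdiff t) hconv u
    · rw [hs_pos t ht]
      exact sq_mul_sub_le_of_convexOn_neg_sqrt ht heven (hdiff t) hconv u
  intro t ht
  have hψs : ψ (s t) = ((t ^ 2 * s t - φ t : ℝ) : EReal) := by
    rw [hψ]
    exact le_antisymm (iInf_le _ t) (le_iInf fun u => EReal.coe_le_coe_iff.2 (hmin t ht u))
  have hattained : (φ t : EReal) = ((t ^ 2 * s t : ℝ) : EReal) - ψ (s t) := by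
    rw [hψs, ← EReal.coe_sub, sub_sub_cancel]
  refine ⟨le_antisymm (le_iInf fun σ => ?_) ?_, hattained, ?_⟩
  · have hle : ψ σ ≤ ((t ^ 2 * σ - φ t : ℝ) : EReal) := by
      rw [hψ]
      exact iInf_le _ t
    calc (φ t : EReal) = ((t ^ 2 * σ : ℝ) : EReal) - ((t ^ 2 * σ - φ t : ℝ) : EReal) := by
          rw [← EReal.coe_sub, sub_sub_cancel]
      _ ≤ ((t ^ 2 * σ : ℝ) : EReal) - ψ σ := EReal.sub_le_sub le_rfl hle
  · exact (iInf_le _ (s t)).trans_eq hattained.symm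
  · rw [hψs, ← EReal.coe_add, add_sub_cancel]
end

section
/- Let λ > 0, let x = (x₁,x₂) ∈ [−π,π)², let w₁ = (−1,1)ᵀ so that ⟨x,w₁⟩ = x₂ − x₁ and ‖w₁‖² = 2, and set s₁ := sgn((⟨x,w₁⟩)_{2π}). If |(⟨x,w₁⟩)_{2π}| < π, then the unique minimizer over y ∈ [−π,π)² of (1/2)[dist(x₁,y₁)² + dist(x₂,y₂)²] + λ·|(y₂ − y₁)_{2π}| is the point (x − s₁·m₁·w₁)_{2π} (applied componentwise), where m₁ := min{λ, |(⟨x,w₁⟩)_{2π}|/2}. -/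
open Real Set

/-- `wrap a` is the unique representative of `a` modulo `2π` lying in `[-π, π)`. -/
noncomputable def wrap (a : ℝ) : ℝ := a - 2 * π * ↑⌊(a + π) / (2 * π)⌋

lemma wrap_mem_Ico (a : ℝ) : wrap a ∈ Ico (-π) π := by
  have hpos : (0 : ℝ) < 2 * π := by positivity
  have h₁ := (le_div_iff₀ hpos).1 (Int.floor_le ((a + π) / (2 * π)))
  have h₂ := (div_lt_iff₀ hpos).1 (Int.lt_floor_add_one ((a + π) / (2 * π)))
  unfold wrap
  constructor <;> linarith

lemma exists_wrap_eq_add (a : ℝ) : ∃ k : ℤ, wrap a = a + 2 * π * k :=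
  ⟨-⌊(a + π) / (2 * π)⌋, by unfold wrap; push_cast; ring⟩

lemma wrap_eq_of_eq_add {a w : ℝ} (hw : w ∈ Ico (-π) π) (k : ℤ) (h : a = w + 2 * π * k) :
    wrap a = w := by
  have hpos : (0 : ℝ) < 2 * π := by positivity
  have hfloor : ⌊(a + π) / (2 * π)⌋ = k := by
    rw [Int.floor_eq_iff, le_div_iff₀ hpos, div_lt_iff₀ hpos]
    constructor <;> nlinarith [hw.1, hw.2]
  rw [wrap, hfloor, h]
  ring

lemma two_pi_le_abs_two_pi_mul_int {k : ℤ} (hk : k ≠ 0) : 2 * π ≤ |2 * π * (k : ℝ)| := by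
  have h : (1 : ℝ) ≤ |(k : ℝ)| := by exact_mod_cast Int.one_le_abs hk
  rw [abs_mul, abs_of_pos (by positivity : (0 : ℝ) < 2 * π)]
  nlinarith [pi_pos]

/-- The value of the objective in excess of the minimum, as a sum of nonnegative terms when
`m = min lam (D / 2)`. -/
lemma prox_excess {lam D m : ℝ} (hm : m = min lam (D / 2)) (a b c : ℝ) :
    (1 / 2) * (|a| ^ 2 + |b| ^ 2) + lam * |c| - (m ^ 2 + lam * (D - 2 * m)) =
      (a + b) ^ 2 / 4 + (|b - a| / 2 - m) ^ 2 + m * (|c| + |b - a| - D) + (lam - m) * |c| := by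
  have h : (lam - m) * (D - 2 * m) = 0 := by
    rcases min_choice lam (D / 2) with h | h <;> rw [hm, h] <;> ring
  linear_combination (1 / 2) * sq_abs a + (1 / 2) * sq_abs b - (1 / 4) * sq_abs (b - a) - h

/-- prox of the first-order cyclic difference on S¹, generic case
|(⟨x,w₁⟩)_{2π}| < π: the unique minimizer over y ∈ [−π,π)² of
(1/2)(dist(x₁,y₁)² + dist(x₂,y₂)²) + λ|(y₂−y₁)_{2π}| is
(x − s₁·m₁·w₁)_{2π} with w₁ = (−1,1), s₁ = sgn((x₂−x₁)_{2π}),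
m₁ = min{λ, |(x₂−x₁)_{2π}|/2}. -/
theorem stmt7 (lam : ℝ) (hlam : 0 < lam) (x₁ x₂ : ℝ)
    (hx₁ : x₁ ∈ Ico (-π) π) (hx₂ : x₂ ∈ Ico (-π) π)
    (d m p₁ p₂ : ℝ)
    (hd : d = wrap (x₂ - x₁))
    (hdlt : |d| < π)
    (hm : m = min lam (|d| / 2))
    (hp₁ : p₁ = wrap (x₁ + Real.sign d * m))
    (hp₂ : p₂ = wrap (x₂ - Real.sign d * m))
    (F : ℝ → ℝ → ℝ)
    (hF : ∀ y₁ y₂ : ℝ, F y₁ y₂ =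
      (1 / 2) * (|wrap (x₁ - y₁)| ^ 2 + |wrap (x₂ - y₂)| ^ 2) +
        lam * |wrap (y₂ - y₁)|) :
    p₁ ∈ Ico (-π) π ∧ p₂ ∈ Ico (-π) π ∧
    (∀ y₁ ∈ Ico (-π) π, ∀ y₂ ∈ Ico (-π) π, F p₁ p₂ ≤ F y₁ y₂) ∧
    (∀ y₁ ∈ Ico (-π) π, ∀ y₂ ∈ Ico (-π) π,
      F y₁ y₂ = F p₁ p₂ → y₁ = p₁ ∧ y₂ = p₂) := by
  have hm0 : 0 ≤ m := hm ▸ le_min hlam.le (by positivity)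
  have hmlam : m ≤ lam := hm ▸ min_le_left _ _
  have hmd : m ≤ |d| / 2 := hm ▸ min_le_right _ _
  obtain ⟨kd, hkd⟩ := exists_wrap_eq_add (x₂ - x₁)
  rw [← hd] at hkd
  set q := Real.sign d * m with hq
  have hsign : (0 ≤ d ∧ |d| = d ∧ q = m) ∨ (d ≤ 0 ∧ |d| = -d ∧ q = -m) := by
    rcases lt_trichotomy d 0 with h | h | h
    · exact Or.inr ⟨h.le, abs_of_neg h, by rw [hq, Real.sign_of_neg h]; ring⟩
    · have : m = 0 := by rw [h, abs_zero] at hmd; linarith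
      exact Or.inl ⟨h.ge, by rw [h, abs_zero], by rw [hq, this, mul_zero]⟩
    · exact Or.inl ⟨h.le, abs_of_pos h, by rw [hq, Real.sign_of_pos h]; ring⟩
  have hqm : |q| = m := by
    rcases hsign with ⟨-, -, h⟩ | ⟨-, -, h⟩ <;> simp [h, abs_of_nonneg hm0]
  have hdq : |d - 2 * q| = |d| - 2 * m := by
    rcases hsign with ⟨-, h, h'⟩ | ⟨-, h, h'⟩
    · rw [h', abs_of_nonneg (by linarith), h]
    · rw [h', abs_of_nonpos (by linarith), h]; ring
  obtain ⟨k₁, hk₁⟩ := exists_wrap_eq_add (x₁ + q)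
  obtain ⟨k₂, hk₂⟩ := exists_wrap_eq_add (x₂ - q)
  rw [← hp₁] at hk₁
  rw [← hp₂] at hk₂
  have hqlt := abs_lt.1 (show |q| < π by linarith)
  have hdqlt := abs_lt.1 (show |d - 2 * q| < π by linarith)
  have hFp : F p₁ p₂ = m ^ 2 + lam * (|d| - 2 * m) := by
    have e₁ : wrap (x₁ - p₁) = -q :=
      wrap_eq_of_eq_add ⟨by linarith, by linarith⟩ (-k₁) (by rw [hk₁]; push_cast; ring)
    have e₂ : wrap (x₂ - p₂) = q :=
      wrap_eq_of_eq_add ⟨by linarith, by linarith⟩ (-k₂) (by rw [hk₂]; push_cast; ring)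
    have e₃ : wrap (p₂ - p₁) = d - 2 * q :=
      wrap_eq_of_eq_add ⟨by linarith, by linarith⟩ (k₂ - k₁ - kd)
        (by rw [hk₁, hk₂, hkd]; push_cast; ring)
    rw [hF, e₁, e₂, e₃, abs_neg, hqm, hdq]
    ring
  have hdecomp : ∀ y₁ y₂ : ℝ, ∃ k : ℤ,
      wrap (y₂ - y₁) + (wrap (x₂ - y₂) - wrap (x₁ - y₁)) = d + 2 * π * k := by
    intro y₁ y₂
    obtain ⟨ka, ha⟩ := exists_wrap_eq_add (x₁ - y₁)
    obtain ⟨kb, hb⟩ := exists_wrap_eq_add (x₂ - y₂)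
    obtain ⟨kc, hc⟩ := exists_wrap_eq_add (y₂ - y₁)
    exact ⟨kc + kb - ka - kd, by rw [ha, hb, hc, hkd]; push_cast; ring⟩
  have hlower : ∀ {c e : ℝ} {k : ℤ}, c + e = d + 2 * π * k →
      |d| ≤ |c| + |e| ∧ (|c| + |e| = |d| → k = 0) := by
    intro c e k h
    have htri := abs_add_le c e
    by_cases hk : k = 0
    · rw [h, hk] at htri
      simp only [Int.cast_zero, mul_zero, add_zero] at htri
      exact ⟨htri, fun _ => hk⟩
    · have h₁ := two_pi_le_abs_two_pi_mul_int hk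
      have h₂ := abs_sub (c + e) d
      rw [show c + e - d = 2 * π * k by rw [h]; ring] at h₂
      exact ⟨by linarith, fun h' => by exfalso; linarith⟩
  have hexcess : ∀ {y₁ y₂ a b c : ℝ}, wrap (x₁ - y₁) = a → wrap (x₂ - y₂) = b →
      wrap (y₂ - y₁) = c → F y₁ y₂ - F p₁ p₂ = (a + b) ^ 2 / 4 + (|b - a| / 2 - m) ^ 2 +
        m * (|c| + |b - a| - |d|) + (lam - m) * |c| := by
    rintro y₁ y₂ _ _ _ rfl rfl rfl
    rw [hFp, hF]
    exact prox_excess hm _ _ _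
  have hrep : ∀ {x y z : ℝ}, y ∈ Ico (-π) π → wrap (x - y) = x - z → y = wrap z := by
    intro x y z hy h
    obtain ⟨k, hk⟩ := exists_wrap_eq_add (x - y)
    exact (wrap_eq_of_eq_add hy (-k) (by push_cast; linarith)).symm
  refine ⟨hp₁ ▸ wrap_mem_Ico _, hp₂ ▸ wrap_mem_Ico _, fun y₁ _ y₂ _ => ?_,
    fun y₁ hy₁ y₂ hy₂ hy => ?_⟩ <;>
  obtain ⟨k, hk⟩ := hdecomp y₁ y₂ <;>
  generalize ha : wrap (x₁ - y₁) = a at hk <;>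
  generalize hb : wrap (x₂ - y₂) = b at hk <;>
  generalize hc : wrap (y₂ - y₁) = c at hk <;>
  obtain ⟨hle, hk0⟩ := hlower hk <;>
  have hex := hexcess ha hb hc <;>
  have t₁ : 0 ≤ (a + b) ^ 2 / 4 := (by positivity) <;>
  have t₂ : 0 ≤ (|b - a| / 2 - m) ^ 2 := (by positivity) <;>
  have t₃ : 0 ≤ m * (|c| + |b - a| - |d|) := mul_nonneg hm0 (by linarith) <;>
  have t₄ : 0 ≤ (lam - m) * |c| := mul_nonneg (by linarith) (abs_nonneg c)
  · linarith
  · have hab : a + b = 0 := by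
      have : (a + b) ^ 2 = 0 := by linarith
      exact pow_eq_zero_iff two_ne_zero |>.1 this
    have he : |b - a| / 2 - m = 0 := by
      have : (|b - a| / 2 - m) ^ 2 = 0 := by linarith
      exact pow_eq_zero_iff two_ne_zero |>.1 this
    have h₃ : m * (|c| + |b - a| - |d|) = 0 := by linarith
    have h₄ : (lam - m) * |c| = 0 := by linarith
    have hsum : |c| + |b - a| = |d| := by
      rcases mul_eq_zero.1 h₃ with h | h
      · rw [h, sub_zero] at h₄
        have := (mul_eq_zero.1 h₄).resolve_left hlam.ne'
        linarith [abs_nonneg d]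
      · linarith
    rw [hk0 hsum, Int.cast_zero, mul_zero, add_zero] at hk
    have hbq : b - a = 2 * q := by
      rcases hsign with ⟨-, h, h'⟩ | ⟨-, h, h'⟩
      · linarith [le_abs_self c, le_abs_self (b - a)]
      · linarith [neg_abs_le c, neg_abs_le (b - a)]
    exact ⟨hp₁ ▸ hrep hy₁ (ha.trans (by linarith)), hp₂ ▸ hrep hy₂ (hb.trans (by linarith))⟩
end
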